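/- Let $F$ be an algebraically closed field of characteristic $2$, $\tilde G$ the Klein four group, and $V$ a non-trivial finite-dimensional $\tilde G$-module decomposed into indecomposable summands. Then $\delta(\tilde G, V) = \gamma(\tilde G, V) = 2$ if and only if every non-trivial indecomposable summand of $V$ is isomorphic to one of $V_{2,0}$, $V_{2,1}$, $W_2$, or $W_{2m+1}$ ($m \ge 1$); otherwise $\delta(\tilde G, V) = \gamma(\tilde G, V) = 4$. -/

import Mathlib

open MvPolynomial

/-- Labels for the isomorphism classes of indecomposable modules of the Klein four
group over an algebraically closed field of characteristic two.  To have strictly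
positive parameters, the label parameter `m` encodes the paper's `m` as `m + 1`:
`vii m lam` is `V_{2(m+1),lam}`, `wiii m` is `W_{2(m+1)}`, `viv m` is `V_{2(m+1)+1}`,
and `wv m` is `W_{2(m+1)+1}`. -/
inductive KLabel (F : Type*) where
  | triv : KLabel F
  | reg : KLabel F
  | vii (m : ℕ) (lam : F) : KLabel F
  | wiii (m : ℕ) : KLabel F
  | viv (m : ℕ) : KLabel F
  | wv (m : ℕ) : KLabel F

/-- Dimension of the indecomposable module with the given label. -/
def kdim {F : Type*} : KLabel F → ℕ
  | .triv => 1
  | .reg => 4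
  | .vii m _ => 2 * (m + 1)
  | .wiii m => 2 * (m + 1)
  | .viv m => 2 * (m + 1) + 1
  | .wv m => 2 * (m + 1) + 1

/-- Matrix (entries indexed by naturals) of `σ₁` on `V_{2M,λ}`: basis
`e_1,…,e_M` (indices `0,…,M-1`), `h_1,…,h_M` (indices `M,…,2M-1`);
`σ₁(h_j) = h_j + e_j`. -/
def viiS1 {F : Type*} [Field F] (M i j : ℕ) : F :=
  (if i = j then 1 else 0) + (if M ≤ j ∧ i = j - M then 1 else 0)

/-- Matrix of `σ₂` on `V_{2M,λ}`: `σ₂(h_j) = h_j + λe_j + e_{j+1}` for `j < M`,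
`σ₂(h_M) = h_M + λe_M`. -/
def viiS2 {F : Type*} [Field F] (M : ℕ) (lam : F) (i j : ℕ) : F :=
  (if i = j then 1 else 0) + (if M ≤ j ∧ i = j - M then lam else 0) +
    (if M ≤ j ∧ j < 2 * M - 1 ∧ i = j - M + 1 then 1 else 0)

/-- Matrix of `σ₁` on `V_{2M+1}`: basis `e_1,…,e_M` (indices `0,…,M-1`),
`h_1,…,h_{M+1}` (indices `M,…,2M`); `σ₁(h_i) = h_i + e_i` for `i ≤ M`,
`σ₁(h_{M+1}) = h_{M+1}`. -/
def vivS1 {F : Type*} [Field F] (M i j : ℕ) : F :=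
  (if i = j then 1 else 0) + (if M ≤ j ∧ j < 2 * M ∧ i = j - M then 1 else 0)

/-- Matrix of `σ₂` on `V_{2M+1}`: `σ₂(h_1) = h_1`, `σ₂(h_i) = h_i + e_{i-1}` for `i ≥ 2`. -/
def vivS2 {F : Type*} [Field F] (M i j : ℕ) : F :=
  (if i = j then 1 else 0) + (if M + 1 ≤ j ∧ i = j - M - 1 then 1 else 0)

/-- Matrix of `σ₁` on `W_{2M+1}`: block matrix `[[I_{M+1}, (I_M; 0)], [0, I_M]]`. -/
def wvS1 {F : Type*} [Field F] (M i j : ℕ) : F :=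
  (if i = j then 1 else 0) + (if M + 1 ≤ j ∧ i = j - (M + 1) then 1 else 0)

/-- Matrix of `σ₂` on `W_{2M+1}`: block matrix `[[I_{M+1}, (0; I_M)], [0, I_M]]`. -/
def wvS2 {F : Type*} [Field F] (M i j : ℕ) : F :=
  (if i = j then 1 else 0) + (if M + 1 ≤ j ∧ i = j - M then 1 else 0)

/-- Matrix of `σ₁` on the regular representation `F G̃` with basis
`1, σ₁, σ₂, σ₁σ₂` (indices `0,1,2,3`): the permutation `0↔1`, `2↔3`. -/
def regS1 {F : Type*} [Field F] (i j : ℕ) : F :=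
  if (i = 0 ∧ j = 1) ∨ (i = 1 ∧ j = 0) ∨ (i = 2 ∧ j = 3) ∨ (i = 3 ∧ j = 2) then 1 else 0

/-- Matrix of `σ₂` on the regular representation: the permutation `0↔2`, `1↔3`. -/
def regS2 {F : Type*} [Field F] (i j : ℕ) : F :=
  if (i = 0 ∧ j = 2) ∨ (i = 2 ∧ j = 0) ∨ (i = 1 ∧ j = 3) ∨ (i = 3 ∧ j = 1) then 1 else 0

/-- The matrix of the first generator `σ₁` on each indecomposable module. -/
def kS1 {F : Type*} [Field F] : (l : KLabel F) → Matrix (Fin (kdim l)) (Fin (kdim l)) F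
  | .triv => 1
  | .reg => fun i j => regS1 (i : ℕ) (j : ℕ)
  | .vii m _ => fun i j => viiS1 (m + 1) (i : ℕ) (j : ℕ)
  | .wiii m => fun i j => viiS2 (m + 1) (0 : F) (i : ℕ) (j : ℕ)
  | .viv m => fun i j => vivS1 (m + 1) (i : ℕ) (j : ℕ)
  | .wv m => fun i j => wvS1 (m + 1) (i : ℕ) (j : ℕ)

/-- The matrix of the second generator `σ₂` on each indecomposable module. -/
def kS2 {F : Type*} [Field F] : (l : KLabel F) → Matrix (Fin (kdim l)) (Fin (kdim l)) F
  | .triv => 1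
  | .reg => fun i j => regS2 (i : ℕ) (j : ℕ)
  | .vii m lam => fun i j => viiS2 (m + 1) lam (i : ℕ) (j : ℕ)
  | .wiii m => fun i j => viiS1 (m + 1) (i : ℕ) (j : ℕ)
  | .viv m => fun i j => vivS2 (m + 1) (i : ℕ) (j : ℕ)
  | .wv m => fun i j => wvS2 (m + 1) (i : ℕ) (j : ℕ)

/-- Blockwise substitution action of `σ₁` on the polynomial ring of
`V = ⊕ᵢ (module with label c i)`. -/
noncomputable def kAct1 {F : Type*} [Field F] {K : ℕ} (c : Fin K → KLabel F) :
    MvPolynomial (Σ i : Fin K, Fin (kdim (c i))) F →ₐ[F]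
      MvPolynomial (Σ i : Fin K, Fin (kdim (c i))) F :=
  aeval fun q => ∑ s : Fin (kdim (c q.1)), C (kS1 (c q.1) q.2 s) * X ⟨q.1, s⟩

/-- Blockwise substitution action of `σ₂`. -/
noncomputable def kAct2 {F : Type*} [Field F] {K : ℕ} (c : Fin K → KLabel F) :
    MvPolynomial (Σ i : Fin K, Fin (kdim (c i))) F →ₐ[F]
      MvPolynomial (Σ i : Fin K, Fin (kdim (c i))) F :=
  aeval fun q => ∑ s : Fin (kdim (c q.1)), C (kS2 (c q.1) q.2 s) * X ⟨q.1, s⟩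

/-- Blockwise action of `σ₁` on points of `V`. -/
def kPt1 {F : Type*} [Field F] {K : ℕ} (c : Fin K → KLabel F)
    (v : (Σ i : Fin K, Fin (kdim (c i))) → F) : (Σ i : Fin K, Fin (kdim (c i))) → F :=
  fun q => ∑ s : Fin (kdim (c q.1)), kS1 (c q.1) q.2 s * v ⟨q.1, s⟩

/-- Blockwise action of `σ₂` on points of `V`. -/
def kPt2 {F : Type*} [Field F] {K : ℕ} (c : Fin K → KLabel F)
    (v : (Σ i : Fin K, Fin (kdim (c i))) → F) : (Σ i : Fin K, Fin (kdim (c i))) → F :=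
  fun q => ∑ s : Fin (kdim (c q.1)), kS2 (c q.1) q.2 s * v ⟨q.1, s⟩

/-- `ε(G̃,v)`. -/
noncomputable def kEps {F : Type*} [Field F] {K : ℕ} (c : Fin K → KLabel F)
    (v : (Σ i : Fin K, Fin (kdim (c i))) → F) : ℕ :=
  sInf {d : ℕ | 0 < d ∧ ∃ f : MvPolynomial (Σ i : Fin K, Fin (kdim (c i))) F,
    kAct1 c f = f ∧ kAct2 c f = f ∧ f.IsHomogeneous d ∧ eval v f ≠ 0}

/-- `δ(G̃,V)`: supremum of `ε` over nonzero fixed points. -/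
noncomputable def kDelta {F : Type*} [Field F] {K : ℕ} (c : Fin K → KLabel F) : ℕ :=
  sSup {e : ℕ | ∃ v : (Σ i : Fin K, Fin (kdim (c i))) → F,
    v ≠ 0 ∧ kPt1 c v = v ∧ kPt2 c v = v ∧ e = kEps c v}

/-- `γ(G̃,V)`: supremum of `ε` over all nonzero points. -/
noncomputable def kGamma {F : Type*} [Field F] {K : ℕ} (c : Fin K → KLabel F) : ℕ :=
  sSup {e : ℕ | ∃ v : (Σ i : Fin K, Fin (kdim (c i))) → F, v ≠ 0 ∧ e = kEps c v}

/-- The summands for which the `δ/γ`-value is `2`: the trivial module, `V_{2,0}`,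
`V_{2,1}`, `W_2`, and `W_{2m+1}` for `m ≥ 1`. -/
def kAllowed {F : Type*} [Zero F] [One F] : KLabel F → Prop
  | .triv => True
  | .reg => False
  | .vii m lam => m = 0 ∧ (lam = 0 ∨ lam = 1)
  | .wiii m => m = 0
  | .viv _ => False
  | .wv _ => True

section Helpers

open scoped Matrix

variable {F : Type*} [Field F]

/-- extension by zero to all naturals -/
def kExt {n : ℕ} (w : Fin n → F) (k : ℕ) : F := if h : k < n then w ⟨k, h⟩ else 0

/-- coordinate polynomial, extended by zero -/
noncomputable def kExtP (F : Type*) [Field F] (n k : ℕ) : MvPolynomial (Fin n) F :=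
  if h : k < n then X ⟨k, h⟩ else 0

lemma eval_kExtP {n : ℕ} (w : Fin n → F) (k : ℕ) : eval w (kExtP F n k) = kExt w k := by
  unfold kExtP kExt; split_ifs <;> simp

lemma kExtP_hom (n k : ℕ) : (kExtP F n k).IsHomogeneous 1 := by
  unfold kExtP; split_ifs
  · exact isHomogeneous_X _ _
  · exact isHomogeneous_zero _ _ _

lemma kExt_sum {n : ℕ} (w : Fin n → F) (P : Fin n → Prop) [DecidablePred P] (k : ℕ)
    (hP : ∀ j : Fin n, P j ↔ j.val = k) :
    ∑ j, (if P j then (1 : F) else 0) * w j = kExt w k := by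
  unfold kExt
  split_ifs with h
  · rw [Finset.sum_eq_single ⟨k, h⟩]
    · rw [if_pos ((hP _).2 rfl)]; simp
    · intro b _ hb
      rw [if_neg]; · simp
      intro hh; exact hb (Fin.ext ((hP b).1 hh))
    · simp
  · apply Finset.sum_eq_zero
    intro j _
    rw [if_neg]; · simp
    intro hh; have := (hP j).1 hh; omega

section CharTwo
variable [CharP F 2]

lemma anti_even (y : ℕ → F) (n : ℕ) :
    ∑ p ∈ Finset.HasAntidiagonal.antidiagonal (2 * n), y p.1 * y p.2 = y n ^ 2 := by
  have hm : ((n, n) : ℕ × ℕ) ∈ Finset.HasAntidiagonal.antidiagonal (2 * n) := by simp; omega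
  rw [← Finset.add_sum_erase _ _ hm]
  have : ∑ p ∈ (Finset.HasAntidiagonal.antidiagonal (2 * n)).erase (n, n), y p.1 * y p.2 = 0 := by
    apply Finset.sum_involution (fun p _ => (p.2, p.1))
    · intro p _; simp only; rw [mul_comm]; exact CharTwo.add_self_eq_zero _
    · rintro ⟨a, b⟩ hp _ he
      simp at hp he
      omega
    · rintro ⟨a, b⟩ hp; simp at hp ⊢; omega
    · intro p _; rfl
  rw [this]; ring

lemma anti_odd (y : ℕ → F) (n : ℕ) :
    ∑ p ∈ Finset.HasAntidiagonal.antidiagonal (2 * n + 1), y p.1 * y p.2 = 0 := by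
  apply Finset.sum_involution (fun p _ => (p.2, p.1))
  · intro p _; simp only; rw [mul_comm]; exact CharTwo.add_self_eq_zero _
  · rintro ⟨a, b⟩ hp _ he
    simp at hp he
    omega
  · rintro ⟨a, b⟩ hp; simp at hp ⊢; omega
  · intro p _; rfl

/-- the quadratic form on sequences -/
def qfun (x y : ℕ → F) (i : ℕ) : F :=
  x i ^ 2 + ∑ p ∈ Finset.HasAntidiagonal.antidiagonal (2 * i), x p.1 * y p.2 +
    (match i with
     | 0 => 0
     | k + 1 => ∑ p ∈ Finset.HasAntidiagonal.antidiagonal (2 * k + 1), x p.1 * y p.2)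

lemma qfun_s1 (x y x' : ℕ → F) (h : ∀ n, x' n = x n + y n) (i : ℕ) :
    qfun x' y i = qfun x y i := by
  unfold qfun
  simp only [h, add_mul, Finset.sum_add_distrib, anti_even, CharTwo.add_sq]
  cases i with
  | zero => simp only; linear_combination (CharTwo.add_self_eq_zero (y 0 ^ 2))
  | succ k =>
    simp only [anti_odd]; linear_combination (CharTwo.add_self_eq_zero (y (k+1) ^ 2))

lemma anti_shift (x' x y : ℕ → F) (h0 : x' 0 = x 0) (h : ∀ n, x' (n + 1) = x (n + 1) + y n)
    (s : ℕ) : ∑ p ∈ Finset.HasAntidiagonal.antidiagonal (s + 1), x' p.1 * y p.2 =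
      ∑ p ∈ Finset.HasAntidiagonal.antidiagonal (s + 1), x p.1 * y p.2 +
      ∑ p ∈ Finset.HasAntidiagonal.antidiagonal s, y p.1 * y p.2 := by
  rw [Finset.Nat.sum_antidiagonal_succ, Finset.Nat.sum_antidiagonal_succ]
  simp only [h0, h, add_mul, Finset.sum_add_distrib]
  ring

lemma qfun_s2 (x y x' : ℕ → F) (h0 : x' 0 = x 0) (h : ∀ n, x' (n + 1) = x (n + 1) + y n)
    (i : ℕ) : qfun x' y i = qfun x y i := by
  unfold qfun
  cases i with
  | zero => simp [h0]
  | succ k =>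
    simp only
    rw [show 2 * (k + 1) = (2 * k + 1) + 1 by ring, anti_shift x' x y h0 h, anti_shift x' x y h0 h,
      anti_odd, anti_even, h, CharTwo.add_sq]
    linear_combination (CharTwo.add_self_eq_zero (y k ^ 2))

/-- The modules `W_{2M+1}` have enough invariants of degree at most two. -/
lemma wv_block (M : ℕ) (w : Fin (2 * M + 1) → F) (hw : w ≠ 0) :
    ∃ d : ℕ, 0 < d ∧ d ≤ 2 ∧ ∃ f : MvPolynomial (Fin (2 * M + 1)) F, f.IsHomogeneous d ∧
      (∀ u, eval ((fun i j => wvS1 M (i : ℕ) (j : ℕ) :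
        Matrix (Fin (2 * M + 1)) (Fin (2 * M + 1)) F) *ᵥ u) f = eval u f) ∧
      (∀ u, eval ((fun i j => wvS2 M (i : ℕ) (j : ℕ) :
        Matrix (Fin (2 * M + 1)) (Fin (2 * M + 1)) F) *ᵥ u) f = eval u f) ∧
      eval w f ≠ 0 := by
  have e1 : ∀ (u : Fin (2 * M + 1) → F) (n : ℕ), kExt ((fun i j => wvS1 M (i : ℕ) (j : ℕ) :
      Matrix (Fin (2 * M + 1)) (Fin (2 * M + 1)) F) *ᵥ u) n = kExt u n + kExt u (n + M + 1) := by
    intro u n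
    by_cases hn : n < 2 * M + 1
    · have : kExt ((fun i j => wvS1 M (i : ℕ) (j : ℕ) :
        Matrix (Fin (2 * M + 1)) (Fin (2 * M + 1)) F) *ᵥ u) n =
        ∑ j : Fin (2 * M + 1), wvS1 M n j * u j := by
        unfold kExt; rw [dif_pos hn]; rfl
      rw [this]
      simp only [wvS1, add_mul, Finset.sum_add_distrib]
      rw [kExt_sum u _ n (fun j => ⟨fun h => h.symm, fun h => h.symm⟩),
        kExt_sum u _ (n + M + 1) (fun j => by omega)]
    · simp [kExt, hn, show ¬ (n + M + 1 < 2 * M + 1) by omega]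
  have e2 : ∀ (u : Fin (2 * M + 1) → F) (n : ℕ), kExt ((fun i j => wvS2 M (i : ℕ) (j : ℕ) :
      Matrix (Fin (2 * M + 1)) (Fin (2 * M + 1)) F) *ᵥ u) n =
      kExt u n + if n = 0 then 0 else kExt u (n + M) := by
    intro u n
    by_cases hn : n < 2 * M + 1
    · have : kExt ((fun i j => wvS2 M (i : ℕ) (j : ℕ) :
        Matrix (Fin (2 * M + 1)) (Fin (2 * M + 1)) F) *ᵥ u) n =
        ∑ j : Fin (2 * M + 1), wvS2 M n j * u j := by
        unfold kExt; rw [dif_pos hn]; rfl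
      rw [this]
      simp only [wvS2, add_mul, Finset.sum_add_distrib]
      rw [kExt_sum u _ n (fun j => ⟨fun h => h.symm, fun h => h.symm⟩)]
      congr 1
      split_ifs with h0
      · apply Finset.sum_eq_zero
        intro j _
        rw [if_neg (by omega), zero_mul]
      · rw [kExt_sum u _ (n + M) (fun j => by omega)]
    · simp [kExt, hn, show ¬ (n + M < 2 * M + 1) by omega]
  by_cases hy : ∃ n, kExt w (n + M + 1) ≠ 0
  · obtain ⟨n, hn⟩ := hy
    refine ⟨1, by norm_num, by norm_num, kExtP F _ (n + M + 1), kExtP_hom _ _, ?_, ?_, ?_⟩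
    · intro u
      rw [eval_kExtP, eval_kExtP, e1]
      simp [kExt, show ¬ (n + M + 1 + M + 1 < 2 * M + 1) by omega]
    · intro u
      rw [eval_kExtP, eval_kExtP, e2]
      simp [kExt, show ¬ (n + M + 1 + M < 2 * M + 1) by omega]
    · rwa [eval_kExtP]
  · push Not at hy
    obtain ⟨q, hq⟩ := Function.ne_iff.1 hw
    have hqM : q.val ≤ M := by
      by_contra hc
      have := hy (q.val - M - 1)
      rw [show q.val - M - 1 + M + 1 = q.val by omega] at this
      simp [kExt] at this
      exact hq (this (by omega))
    set P : MvPolynomial (Fin (2 * M + 1)) F :=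
      kExtP F _ q ^ 2 + ∑ p ∈ Finset.HasAntidiagonal.antidiagonal (2 * q.val),
        (if p.1 ≤ M then kExtP F _ p.1 else 0) * kExtP F _ (p.2 + M + 1) +
      (match q.val with
       | 0 => 0
       | k + 1 => ∑ p ∈ Finset.HasAntidiagonal.antidiagonal (2 * k + 1),
          (if p.1 ≤ M then kExtP F _ p.1 else 0) * kExtP F _ (p.2 + M + 1)) with hPdef
    have hx : ∀ n : ℕ, (if n ≤ M then kExtP F (2 * M + 1) n else 0).IsHomogeneous 1 := by
      intro n
      split_ifs
      · exact kExtP_hom _ _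
      · exact isHomogeneous_zero _ _ _
    have hP : P.IsHomogeneous 2 := by
      refine ((((kExtP_hom _ _).pow 2).add ?_).add ?_)
      · exact IsHomogeneous.sum _ _ _ fun p _ => (hx _).mul (kExtP_hom _ _)
      · cases q.val with
        | zero => exact isHomogeneous_zero _ _ _
        | succ k => exact IsHomogeneous.sum _ _ _ fun p _ => (hx _).mul (kExtP_hom _ _)
    have hev : ∀ u, eval u P = qfun (fun n => if n ≤ M then kExt u n else 0)
        (fun n => kExt u (n + M + 1)) q.val := by
      intro u
      have hx' : ∀ n : ℕ, eval u (if n ≤ M then kExtP F (2 * M + 1) n else 0) =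
          if n ≤ M then kExt u n else 0 := by
        intro n; split_ifs <;> simp [eval_kExtP]
      rw [hPdef]
      unfold qfun
      simp only [map_add, map_pow, map_sum, map_mul, eval_kExtP, hx', if_pos hqM]
      congr 1
      cases q.val with
      | zero => simp
      | succ k => simp only [map_sum, map_mul, eval_kExtP, hx']
    refine ⟨2, by norm_num, le_rfl, P, hP, ?_, ?_, ?_⟩
    · intro u
      rw [hev, hev]
      have hyy : (fun n => kExt ((fun i j => wvS1 M (i : ℕ) (j : ℕ) :
        Matrix (Fin (2 * M + 1)) (Fin (2 * M + 1)) F) *ᵥ u) (n + M + 1)) =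
        fun n => kExt u (n + M + 1) := by
        funext n
        rw [e1]
        simp [kExt, show ¬ (n + M + 1 + M + 1 < 2 * M + 1) by omega]
      rw [hyy]
      apply qfun_s1
      intro n
      split_ifs with hn
      · rw [e1]
      · simp [kExt, show ¬ (n + M + 1 < 2 * M + 1) by omega]
    · intro u
      rw [hev, hev]
      have hyy : (fun n => kExt ((fun i j => wvS2 M (i : ℕ) (j : ℕ) :
        Matrix (Fin (2 * M + 1)) (Fin (2 * M + 1)) F) *ᵥ u) (n + M + 1)) =
        fun n => kExt u (n + M + 1) := by
        funext n
        rw [e2]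
        simp [kExt, show ¬ (n + M + 1 + M < 2 * M + 1) by omega]
      rw [hyy]
      apply qfun_s2
      · simp [e2]
      intro n
      split_ifs with hn
      · rw [e2, if_neg (by omega), show n + 1 + M = n + M + 1 by ring]
      · simp [kExt, show ¬ (n + M + 1 < 2 * M + 1) by omega]
    · rw [hev]
      have : (fun n => kExt w (n + M + 1)) = fun _ => 0 := funext hy
      rw [this]
      unfold qfun
      have h2 : kExt w q.val ≠ 0 := by simpa [kExt, Nat.lt_succ_iff.1 q.isLt] using hq
      simp only [if_pos hqM, mul_zero, Finset.sum_const_zero, add_zero]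
      cases hqv : q.val <;> simpa [hqv] using h2

/-- Block-level invariants of degree at most two. -/
lemma allowed_block (l : KLabel F) (hl : kAllowed l) (w : Fin (kdim l) → F) (hw : w ≠ 0) :
    ∃ d : ℕ, 0 < d ∧ d ≤ 2 ∧ ∃ f : MvPolynomial (Fin (kdim l)) F, f.IsHomogeneous d ∧
      (∀ u, eval (kS1 l *ᵥ u) f = eval u f) ∧ (∀ u, eval (kS2 l *ᵥ u) f = eval u f) ∧
      eval w f ≠ 0 := by
  cases l with
  | triv =>
    obtain ⟨q, hq⟩ := Function.ne_iff.1 hw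
    exact ⟨1, by norm_num, by norm_num, X q, isHomogeneous_X _ _, by simp [kS1], by simp [kS2],
      by simpa using hq⟩
  | reg => exact hl.elim
  | viv m => exact hl.elim
  | vii m lam =>
    obtain ⟨rfl, hlam⟩ := hl
    change Fin 2 → F at w
    change ∃ d : ℕ, 0 < d ∧ d ≤ 2 ∧ ∃ f : MvPolynomial (Fin 2) F, f.IsHomogeneous d ∧
      (∀ u, eval ((fun i j : Fin 2 => viiS1 1 (i : ℕ) (j : ℕ) : Matrix (Fin 2) (Fin 2) F) *ᵥ u) f
        = eval u f) ∧
      (∀ u, eval ((fun i j : Fin 2 => viiS2 1 lam (i : ℕ) (j : ℕ) : Matrix (Fin 2) (Fin 2) F) *ᵥ u) f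
        = eval u f) ∧ eval w f ≠ 0
    by_cases h1 : w 1 = 0
    · refine ⟨2, by norm_num, le_rfl, X 0 * (X 0 + X 1),
        (isHomogeneous_X _ _).mul ((isHomogeneous_X _ _).add (isHomogeneous_X _ _)), ?_, ?_, ?_⟩
      · intro u
        simp [Matrix.mulVec, dotProduct, viiS1, Fin.sum_univ_two]
        linear_combination (u 1 * (u 0 + u 1)) * CharTwo.two_eq_zero (R := F)
      · intro u
        rcases hlam with rfl | rfl
        · simp [Matrix.mulVec, dotProduct, viiS2, Fin.sum_univ_two]
        · simp [Matrix.mulVec, dotProduct, viiS2, Fin.sum_univ_two]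
          linear_combination (u 1 * (u 0 + u 1)) * CharTwo.two_eq_zero (R := F)
      · simp [h1]
        intro h0
        apply hw
        funext q
        fin_cases q
        · exact h0
        · exact h1
    · refine ⟨1, by norm_num, by norm_num, X 1, isHomogeneous_X _ _, ?_, ?_, by simpa using h1⟩
      · intro u
        simp [Matrix.mulVec, dotProduct, viiS1, Fin.sum_univ_two]
      · intro u
        simp [Matrix.mulVec, dotProduct, viiS2, Fin.sum_univ_two]
  | wiii m =>
    obtain rfl : m = 0 := hl
    change Fin 2 → F at w
    change ∃ d : ℕ, 0 < d ∧ d ≤ 2 ∧ ∃ f : MvPolynomial (Fin 2) F, f.IsHomogeneous d ∧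
      (∀ u, eval ((fun i j : Fin 2 => viiS2 1 0 (i : ℕ) (j : ℕ) : Matrix (Fin 2) (Fin 2) F) *ᵥ u) f
        = eval u f) ∧
      (∀ u, eval ((fun i j : Fin 2 => viiS1 1 (i : ℕ) (j : ℕ) : Matrix (Fin 2) (Fin 2) F) *ᵥ u) f
        = eval u f) ∧ eval w f ≠ 0
    by_cases h1 : w 1 = 0
    · refine ⟨2, by norm_num, le_rfl, X 0 * (X 0 + X 1),
        (isHomogeneous_X _ _).mul ((isHomogeneous_X _ _).add (isHomogeneous_X _ _)), ?_, ?_, ?_⟩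
      · intro u
        simp [Matrix.mulVec, dotProduct, viiS2, Fin.sum_univ_two]
      · intro u
        simp [Matrix.mulVec, dotProduct, viiS1, Fin.sum_univ_two]
        linear_combination (u 1 * (u 0 + u 1)) * CharTwo.two_eq_zero (R := F)
      · simp [h1]
        intro h0
        apply hw
        funext q
        fin_cases q
        · exact h0
        · exact h1
    · refine ⟨1, by norm_num, by norm_num, X 1, isHomogeneous_X _ _, ?_, ?_, by simpa using h1⟩
      · intro u
        simp [Matrix.mulVec, dotProduct, viiS2, Fin.sum_univ_two]
      · intro u
        simp [Matrix.mulVec, dotProduct, viiS1, Fin.sum_univ_two]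
  | wv m => exact wv_block (m + 1) w hw


/-- Block-upper-triangular unipotent matrices satisfy the Klein four relations. -/
lemma unip_mul {n : ℕ} (p : ℕ) (A B : Matrix (Fin n) (Fin n) F)
    (hA : ∀ i j, (i.val < p ∧ p ≤ j.val) ∨ A i j = (1 : Matrix (Fin n) (Fin n) F) i j)
    (hB : ∀ i j, (i.val < p ∧ p ≤ j.val) ∨ B i j = (1 : Matrix (Fin n) (Fin n) F) i j) :
    A * B = A + B - 1 := by
  have h : (A - 1) * (B - 1) = 0 := by
    ext i j
    rw [Matrix.mul_apply]
    apply Finset.sum_eq_zero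
    intro k _
    rcases hA i k with h1 | h1
    · rcases hB k j with h2 | h2
      · omega
      · simp [h2]
    · simp [h1]
  have h2 : A * B - (A + B - 1) = (A - 1) * (B - 1) := by noncomm_ring
  rw [h] at h2
  exact sub_eq_zero.1 h2

lemma unip_rel {n : ℕ} (p : ℕ) (A B : Matrix (Fin n) (Fin n) F)
    (hA : ∀ i j, (i.val < p ∧ p ≤ j.val) ∨ A i j = (1 : Matrix (Fin n) (Fin n) F) i j)
    (hB : ∀ i j, (i.val < p ∧ p ≤ j.val) ∨ B i j = (1 : Matrix (Fin n) (Fin n) F) i j) :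
    A * A = 1 ∧ B * B = 1 ∧ A * B = B * A := by
  refine ⟨?_, ?_, ?_⟩
  · rw [unip_mul p A A hA hA]
    ext i j
    simp only [Matrix.sub_apply, Matrix.add_apply, CharTwo.add_self_eq_zero, CharTwo.sub_eq_add,
      zero_add]
  · rw [unip_mul p B B hB hB]
    ext i j
    simp only [Matrix.sub_apply, Matrix.add_apply, CharTwo.add_self_eq_zero, CharTwo.sub_eq_add,
      zero_add]
  · rw [unip_mul p A B hA hB, unip_mul p B A hB hA, add_comm]

lemma reg_rel :
    let A : Matrix (Fin 4) (Fin 4) F := Matrix.of fun i j => regS1 (i : ℕ) (j : ℕ)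
    let B : Matrix (Fin 4) (Fin 4) F := Matrix.of fun i j => regS2 (i : ℕ) (j : ℕ)
    A * A = 1 ∧ B * B = 1 ∧ A * B = B * A := by
  intro A B
  refine ⟨?_, ?_, ?_⟩ <;>
  · ext i j
    fin_cases i <;> fin_cases j <;>
      simp [A, B, Matrix.mul_apply, Fin.sum_univ_four, regS1, regS2, Matrix.one_apply]

lemma kS_rel (l : KLabel F) :
    kS1 l * kS1 l = 1 ∧ kS2 l * kS2 l = 1 ∧ kS1 l * kS2 l = kS2 l * kS1 l := by
  cases l with
  | triv => simp [kS1, kS2]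
  | reg =>
    exact ⟨reg_rel.1, reg_rel.2.1, reg_rel.2.2⟩
  | vii m lam =>
    apply unip_rel (m + 1) <;> intro i j <;> have hi : i.val < 2 * (m + 1) := i.isLt <;>
      have hj : j.val < 2 * (m + 1) := j.isLt <;> by_cases h : i.val < m + 1 ∧ m + 1 ≤ j.val <;>
      [left; right; left; right] <;> first | exact h | skip
    · simp [kS1, viiS1, Matrix.one_apply, Fin.ext_iff]; omega
    · have h1 : ¬ (m + 1 ≤ j.val ∧ i.val = j.val - (m + 1)) := by omega
      have h2 : ¬ (m + 1 ≤ j.val ∧ j.val < 2 * (m + 1) - 1 ∧ i.val = j.val - (m + 1) + 1) := by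
        omega
      simp only [kS2, viiS2, Matrix.one_apply, Fin.ext_iff, if_neg h1, if_neg h2, add_zero]
  | wiii m =>
    apply unip_rel (m + 1) <;> intro i j <;> have hi : i.val < 2 * (m + 1) := i.isLt <;>
      have hj : j.val < 2 * (m + 1) := j.isLt <;> by_cases h : i.val < m + 1 ∧ m + 1 ≤ j.val <;>
      [left; right; left; right] <;> first | exact h | skip
    · have h1 : ¬ (m + 1 ≤ j.val ∧ i.val = j.val - (m + 1)) := by omega
      have h2 : ¬ (m + 1 ≤ j.val ∧ j.val < 2 * (m + 1) - 1 ∧ i.val = j.val - (m + 1) + 1) := by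
        omega
      simp only [kS1, viiS2, Matrix.one_apply, Fin.ext_iff, if_neg h1, if_neg h2, add_zero]
    · simp [kS2, viiS1, Matrix.one_apply, Fin.ext_iff]; omega
  | viv m =>
    apply unip_rel (m + 1) <;> intro i j <;> have hi : i.val < 2 * (m + 1) + 1 := i.isLt <;>
      have hj : j.val < 2 * (m + 1) + 1 := j.isLt <;> by_cases h : i.val < m + 1 ∧ m + 1 ≤ j.val <;>
      [left; right; left; right] <;> first | exact h | skip
    · simp [kS1, vivS1, Matrix.one_apply, Fin.ext_iff]; omega
    · simp [kS2, vivS2, Matrix.one_apply, Fin.ext_iff]; omega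
  | wv m =>
    apply unip_rel (m + 1 + 1) <;> intro i j <;> have hi : i.val < 2 * (m + 1) + 1 := i.isLt <;>
      have hj : j.val < 2 * (m + 1) + 1 := j.isLt <;>
      by_cases h : i.val < m + 1 + 1 ∧ m + 1 + 1 ≤ j.val <;>
      [left; right; left; right] <;> first | exact h | skip
    · simp [kS1, wvS1, Matrix.one_apply, Fin.ext_iff]; omega
    · simp [kS2, wvS2, Matrix.one_apply, Fin.ext_iff]; omega

/-- unit vectors -/
def ev (F : Type*) [Field F] (n k : ℕ) : Fin n → F := fun i => if i.val = k then 1 else 0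

lemma mulVec_ev {n k : ℕ} (hk : k < n) (a : ℕ → ℕ → F) :
    (Matrix.of fun i j : Fin n => a i j) *ᵥ ev F n k = fun i : Fin n => a i k := by
  have : ev F n k = Pi.single ⟨k, hk⟩ 1 := by
    funext i
    simp [ev, Pi.single_apply, Fin.ext_iff]
  rw [this, Matrix.mulVec_single_one]
  rfl

/-- Witness that all invariants of degrees 1, 2, 3 vanish at a fixed point. -/
def BadMat {n : ℕ} (A B : Matrix (Fin n) (Fin n) F) : Prop :=
  ∃ v h g u : Fin n → F, v ≠ 0 ∧ A *ᵥ v = v ∧ B *ᵥ v = v ∧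
    ((A *ᵥ h = h + v ∧ B *ᵥ g = g + v ∧ B *ᵥ h = h) ∨
     (B *ᵥ h = h + v ∧ A *ᵥ g = g + v ∧ A *ᵥ h = h) ∨
     (A *ᵥ h = h + v ∧ B *ᵥ h = h + v ∧ A *ᵥ g = g + u ∧ B *ᵥ g = g + u + v ∧ A *ᵥ u = u) ∨
     (∃ a : F, a ≠ 0 ∧ a ≠ 1 ∧ A *ᵥ h = h + v ∧ B *ᵥ h = h + a • v))

lemma ev_ne {n k : ℕ} (hk : k < n) : ev F n k ≠ 0 := by
  intro h
  have := congrFun h ⟨k, hk⟩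
  simp [ev] at this

lemma bad_reg : BadMat (Matrix.of fun i j : Fin 4 => (regS1 (i : ℕ) (j : ℕ) : F))
    (Matrix.of fun i j : Fin 4 => (regS2 (i : ℕ) (j : ℕ) : F)) := by
  refine ⟨![1, 1, 1, 1], ![1, 0, 1, 0], ![1, 1, 0, 0], 0, ?_, ?_, ?_, Or.inl ⟨?_, ?_, ?_⟩⟩
  · intro h
    exact one_ne_zero (congrFun h (0 : Fin 4))
  all_goals
    funext i
    fin_cases i <;> simp [Matrix.mulVec, dotProduct, Fin.sum_univ_four, regS1, regS2,
      CharTwo.add_self_eq_zero]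

lemma bad_viv (m : ℕ) :
    BadMat (Matrix.of fun i j : Fin (2 * (m + 1) + 1) => (vivS1 (m + 1) (i : ℕ) (j : ℕ) : F))
    (Matrix.of fun i j : Fin (2 * (m + 1) + 1) => (vivS2 (m + 1) (i : ℕ) (j : ℕ) : F)) := by
  refine ⟨ev F _ m, ev F _ (2 * m + 2), ev F _ (2 * m + 1), 0, ev_ne (by omega), ?_, ?_,
    Or.inr (Or.inl ⟨?_, ?_, ?_⟩)⟩
  all_goals
    rw [mulVec_ev (by omega)]
    funext i
    simp only [vivS1, vivS2, ev, Pi.add_apply]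
    split_ifs <;> first | omega | simp

/-- Case `λ = 0`, `M ≥ 2`. -/
lemma bad_vii0 (m : ℕ) (hm : m ≠ 0) :
    BadMat (Matrix.of fun i j : Fin (2 * (m + 1)) => (viiS1 (m + 1) (i : ℕ) (j : ℕ) : F))
    (Matrix.of fun i j : Fin (2 * (m + 1)) => (viiS2 (m + 1) 0 (i : ℕ) (j : ℕ) : F)) := by
  refine ⟨ev F _ m, ev F _ (2 * m + 1), ev F _ (2 * m), 0, ev_ne (by omega), ?_, ?_,
    Or.inl ⟨?_, ?_, ?_⟩⟩
  all_goals
    rw [mulVec_ev (by omega)]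
    funext i
    simp only [viiS1, viiS2, ev, Pi.add_apply]
    split_ifs <;> first | omega | simp

lemma bad_wiii (m : ℕ) (hm : m ≠ 0) :
    BadMat (Matrix.of fun i j : Fin (2 * (m + 1)) => (viiS2 (m + 1) 0 (i : ℕ) (j : ℕ) : F))
    (Matrix.of fun i j : Fin (2 * (m + 1)) => (viiS1 (m + 1) (i : ℕ) (j : ℕ) : F)) := by
  refine ⟨ev F _ m, ev F _ (2 * m + 1), ev F _ (2 * m), 0, ev_ne (by omega), ?_, ?_,
    Or.inr (Or.inl ⟨?_, ?_, ?_⟩)⟩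
  all_goals
    rw [mulVec_ev (by omega)]
    funext i
    simp only [viiS1, viiS2, ev, Pi.add_apply]
    split_ifs <;> first | omega | simp

/-- Case `λ = 1`, `M ≥ 2`. -/
lemma bad_vii1 (m : ℕ) (hm : m ≠ 0) :
    BadMat (Matrix.of fun i j : Fin (2 * (m + 1)) => (viiS1 (m + 1) (i : ℕ) (j : ℕ) : F))
    (Matrix.of fun i j : Fin (2 * (m + 1)) => (viiS2 (m + 1) 1 (i : ℕ) (j : ℕ) : F)) := by
  refine ⟨ev F _ m, ev F _ (2 * m + 1), ev F _ (2 * m), ev F _ (m - 1), ev_ne (by omega), ?_, ?_,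
    Or.inr (Or.inr (Or.inl ⟨?_, ?_, ?_, ?_, ?_⟩))⟩
  all_goals
    rw [mulVec_ev (by omega)]
    funext i
    simp only [viiS1, viiS2, ev, Pi.add_apply]
    split_ifs <;> first | omega | simp

/-- Case `λ ≠ 0, 1`. -/
lemma bad_vii2 (m : ℕ) (lam : F) (h0 : lam ≠ 0) (h1 : lam ≠ 1) :
    BadMat (Matrix.of fun i j : Fin (2 * (m + 1)) => (viiS1 (m + 1) (i : ℕ) (j : ℕ) : F))
    (Matrix.of fun i j : Fin (2 * (m + 1)) => (viiS2 (m + 1) lam (i : ℕ) (j : ℕ) : F)) := by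
  refine ⟨ev F _ m, ev F _ (2 * m + 1), 0, 0, ev_ne (by omega), ?_, ?_,
    Or.inr (Or.inr (Or.inr ⟨lam, h0, h1, ?_, ?_⟩))⟩
  all_goals
    rw [mulVec_ev (by omega)]
    funext i
    simp only [viiS1, viiS2, ev, Pi.add_apply, Pi.smul_apply, smul_eq_mul]
    split_ifs <;> first | omega | simp

lemma bad_block (l : KLabel F) (hl : ¬ kAllowed l) : BadMat (kS1 l) (kS2 l) := by
  cases l with
  | triv => exact (hl trivial).elim
  | wv m => exact (hl trivial).elim
  | reg => exact bad_reg
  | viv m => exact bad_viv m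
  | wiii m => exact bad_wiii m hl
  | vii m lam =>
    by_cases h0 : lam = 0
    · subst h0
      exact bad_vii0 m fun hm => hl ⟨hm, Or.inl rfl⟩
    by_cases h1 : lam = 1
    · subst h1
      exact bad_vii1 m fun hm => hl ⟨hm, Or.inr rfl⟩
    exact bad_vii2 m lam h0 h1

/-- A fixed point at which all invariants of degree 1 vanish. -/
def MovMat {n : ℕ} (A B : Matrix (Fin n) (Fin n) F) : Prop :=
  ∃ v h : Fin n → F, v ≠ 0 ∧ A *ᵥ v = v ∧ B *ᵥ v = v ∧ (A *ᵥ h = h + v ∨ B *ᵥ h = h + v)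

lemma BadMat.mov {n : ℕ} {A B : Matrix (Fin n) (Fin n) F} (hb : BadMat A B) : MovMat A B := by
  obtain ⟨v, h, g, u, hv, h1, h2, h3⟩ := hb
  refine ⟨v, h, hv, h1, h2, ?_⟩
  rcases h3 with h3 | h3 | h3 | ⟨a, _, _, h3, _⟩
  · exact Or.inl h3.1
  · exact Or.inr h3.1
  · exact Or.inl h3.1
  · exact Or.inl h3

lemma mov_vii (m : ℕ) (lam : F) :
    MovMat (Matrix.of fun i j : Fin (2 * (m + 1)) => (viiS1 (m + 1) (i : ℕ) (j : ℕ) : F))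
    (Matrix.of fun i j : Fin (2 * (m + 1)) => (viiS2 (m + 1) lam (i : ℕ) (j : ℕ) : F)) := by
  refine ⟨ev F _ m, ev F _ (2 * m + 1), ev_ne (by omega), ?_, ?_, Or.inl ?_⟩
  all_goals
    rw [mulVec_ev (by omega)]
    funext i
    simp only [viiS1, viiS2, ev, Pi.add_apply]
    split_ifs <;> first | omega | simp

lemma mov_wv (m : ℕ) :
    MovMat (Matrix.of fun i j : Fin (2 * (m + 1) + 1) => (wvS1 (m + 1) (i : ℕ) (j : ℕ) : F))
    (Matrix.of fun i j : Fin (2 * (m + 1) + 1) => (wvS2 (m + 1) (i : ℕ) (j : ℕ) : F)) := by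
  refine ⟨ev F _ m, ev F _ (2 * m + 2), ev_ne (by omega), ?_, ?_, Or.inl ?_⟩
  all_goals
    rw [mulVec_ev (by omega)]
    funext i
    simp only [wvS1, wvS2, ev, Pi.add_apply]
    split_ifs <;> first | omega | simp

lemma mov_block (l : KLabel F) (hl : l ≠ KLabel.triv) : MovMat (kS1 l) (kS2 l) := by
  cases l with
  | triv => exact (hl rfl).elim
  | wv m => exact mov_wv m
  | reg => exact bad_reg.mov
  | viv m => exact (bad_viv m).mov
  | wiii m =>
    obtain ⟨v, h, hv, h1, h2, h3⟩ := mov_vii m (0 : F)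
    exact ⟨v, h, hv, h2, h1, h3.symm⟩
  | vii m lam => exact mov_vii m lam

lemma hom_one {σ : Type*} {f : MvPolynomial σ F} (hf : f.IsHomogeneous 1) :
    (∀ a b : σ → F, eval (a + b) f = eval a f + eval b f) ∧
    (∀ (t : F) (a : σ → F), eval (t • a) f = t * eval a f) := by
  have hf' : f ∈ Submodule.span F (Set.range (X : σ → MvPolynomial σ F)) := by
    rw [← homogeneousSubmodule_one_eq_span_X]; exact hf
  clear hf
  induction hf' using Submodule.span_induction with
  | mem x h => obtain ⟨i, rfl⟩ := h; simp
  | zero => simp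
  | add x y _ _ hx hy =>
    refine ⟨fun a b => ?_, fun t a => ?_⟩
    · simp only [map_add, hx.1, hy.1]; ring
    · simp only [map_add, hx.2, hy.2]; ring
  | smul r x _ hx =>
    refine ⟨fun a b => ?_, fun t a => ?_⟩
    · simp only [smul_eval, hx.1]; ring
    · simp only [smul_eval, hx.2]; ring

lemma hom_two {σ : Type*} {f : MvPolynomial σ F} (hf : f.IsHomogeneous 2) :
    (∀ x y z : σ → F, eval (x + y + z) f + eval x f + eval y f + eval z f =
      eval (x + y) f + eval (x + z) f + eval (y + z) f) ∧
    (∀ h v : σ → F, ∃ e : F, ∀ t : F,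
      eval (h + t • v) f = eval h f + e * t + t ^ 2 * eval v f) := by
  have hf' : f ∈ homogeneousSubmodule σ F 1 * homogeneousSubmodule σ F 1 := by
    rw [← pow_two, homogeneousSubmodule_one_pow]; exact hf
  clear hf
  induction hf' using Submodule.mul_induction_on' with
  | mem_mul_mem m hm n hn =>
    obtain ⟨m1, m2⟩ := hom_one hm
    obtain ⟨n1, n2⟩ := hom_one hn
    refine ⟨fun x y z => ?_, fun h v => ⟨eval h m * eval v n + eval v m * eval h n, fun t => ?_⟩⟩
    · simp only [map_mul, m1, n1]; ring
    · simp only [map_mul, m1, n1, m2, n2]; ring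
  | add x _ y _ hx hy =>
    refine ⟨fun a b d => ?_, fun h v => ?_⟩
    · simp only [map_add]
      linear_combination hx.1 a b d + hy.1 a b d
    · obtain ⟨e, he⟩ := hx.2 h v
      obtain ⟨e', he'⟩ := hy.2 h v
      refine ⟨e + e', fun t => ?_⟩
      simp only [map_add, he, he']; ring

lemma hom_three {σ : Type*} {f : MvPolynomial σ F} (hf : f.IsHomogeneous 3)
    (h v : σ → F) : ∃ e e' : F, ∀ t : F,
      eval (h + t • v) f = eval h f + e * t + e' * t ^ 2 + t ^ 3 * eval v f := by
  have hf' : f ∈ homogeneousSubmodule σ F 2 * homogeneousSubmodule σ F 1 := by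
    have e2 : homogeneousSubmodule σ F 2 = homogeneousSubmodule σ F 1 ^ 2 :=
      by rw [homogeneousSubmodule_one_pow]
    rw [e2, ← pow_succ, homogeneousSubmodule_one_pow]; exact hf
  clear hf
  induction hf' using Submodule.mul_induction_on' with
  | mem_mul_mem m hm n hn =>
    obtain ⟨e, he⟩ := (hom_two hm).2 h v
    obtain ⟨n1, n2⟩ := hom_one hn
    refine ⟨e * eval h n + eval h m * eval v n, e * eval v n + eval v m * eval h n, fun t => ?_⟩
    simp only [map_mul, he, n1, n2]; ring
  | add x _ y _ hx hy =>
    obtain ⟨e, e', he⟩ := hx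
    obtain ⟨d, d', hd⟩ := hy
    refine ⟨e + d, e' + d', fun t => ?_⟩
    simp only [map_add, he, hd]; ring

section Global
variable {K : ℕ} (c : Fin K → KLabel F)

/-- inclusion of a block -/
def kIn (i : Fin K) (w : Fin (kdim (c i)) → F) : (Σ i : Fin K, Fin (kdim (c i))) → F :=
  fun q => (Pi.single i w : ∀ i, Fin (kdim (c i)) → F) q.1 q.2

lemma kIn_self (i : Fin K) (w : Fin (kdim (c i)) → F) (s) : kIn c i w ⟨i, s⟩ = w s := by
  simp [kIn]

lemma kIn_add (i : Fin K) (w w' : Fin (kdim (c i)) → F) :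
    kIn c i (w + w') = kIn c i w + kIn c i w' := by
  funext q
  simp [kIn, Pi.single_add]

lemma kIn_smul (i : Fin K) (t : F) (w : Fin (kdim (c i)) → F) :
    kIn c i (t • w) = t • kIn c i w := by
  funext q
  simp [kIn, Pi.single_smul]

lemma kPt1_kIn (i : Fin K) (w : Fin (kdim (c i)) → F) :
    kPt1 c (kIn c i w) = kIn c i (kS1 (c i) *ᵥ w) := by
  funext ⟨j, s⟩
  by_cases hj : j = i
  · subst hj
    simp only [kPt1, kIn_self]
    rfl
  · simp [kPt1, kIn, Pi.single_eq_of_ne hj]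

lemma kPt2_kIn (i : Fin K) (w : Fin (kdim (c i)) → F) :
    kPt2 c (kIn c i w) = kIn c i (kS2 (c i) *ᵥ w) := by
  funext ⟨j, s⟩
  by_cases hj : j = i
  · subst hj
    simp only [kPt2, kIn_self]
    rfl
  · simp [kPt2, kIn, Pi.single_eq_of_ne hj]

lemma kIn_ne (i : Fin K) (w : Fin (kdim (c i)) → F) (hw : w ≠ 0) : kIn c i w ≠ 0 := by
  obtain ⟨s, hs⟩ := Function.ne_iff.1 hw
  intro h
  apply hs
  have := congrFun h ⟨i, s⟩
  rwa [kIn_self] at this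

lemma eval_kAct1 (v) (f) : eval v (kAct1 c f) = eval (kPt1 c v) f := by
  induction f using MvPolynomial.induction_on with
  | C a => simp [kAct1]
  | add p q hp hq => simp [hp, hq]
  | mul_X p n hp => rw [map_mul, map_mul, map_mul, hp]; simp [kAct1, kPt1]

lemma eval_kAct2 (v) (f) : eval v (kAct2 c f) = eval (kPt2 c v) f := by
  induction f using MvPolynomial.induction_on with
  | C a => simp [kAct2]
  | add p q hp hq => simp [hp, hq]
  | mul_X p n hp => rw [map_mul, map_mul, map_mul, hp]; simp [kAct2, kPt2]

lemma odd_vanish [Infinite F] (i : Fin K) (A : Matrix (Fin (kdim (c i))) (Fin (kdim (c i))) F)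
    (v h : Fin (kdim (c i)) → F)
    (hv : A *ᵥ v = v) (hh : A *ᵥ h = h + v) (f : MvPolynomial (Σ i : Fin K, Fin (kdim (c i))) F)
    (hA : ∀ w, eval (kIn c i (A *ᵥ w)) f = eval (kIn c i w) f)
    (hf : f.IsHomogeneous 1 ∨ f.IsHomogeneous 3) : eval (kIn c i v) f = 0 := by
  rcases hf with hf | hf
  · have := hA h
    rw [hh, kIn_add, (hom_one hf).1] at this
    simpa using this
  · obtain ⟨e, e', he⟩ := hom_three hf (kIn c i h) (kIn c i v)
    have key : ∀ t : F, eval (kIn c i v) f * (t ^ 2 + t + 1) + e + e' = 0 := by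
      intro t
      have h1 := hA (h + t • v)
      have h2 : A *ᵥ (h + t • v) = h + (t + 1) • v := by
        rw [Matrix.mulVec_add, Matrix.mulVec_smul, hh, hv]; module
      rw [h2, kIn_add, kIn_smul, kIn_add, kIn_smul, he, he] at h1
      have two := CharTwo.two_eq_zero (R := F)
      linear_combination h1 - (e' * t + (t ^ 2 + t) * eval (kIn c i v) f) * two
    classical
    obtain ⟨t, ht⟩ := Set.Infinite.exists_notMem_finset (Set.infinite_univ (α := F)) ({0, -1} : Finset F)
    simp at ht
    have h0 := key 0
    have h1 := key t
    have : eval (kIn c i v) f * (t * (t + 1)) = 0 := by linear_combination h1 - h0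
    have ht' : t * (t + 1) ≠ 0 := mul_ne_zero ht.1 fun h => ht.2 (eq_neg_of_add_eq_zero_left h)
    exact (mul_eq_zero.1 this).resolve_right ht'

lemma two_vanish (i : Fin K) (v h g : Fin (kdim (c i)) → F)
    (f : MvPolynomial (Σ i : Fin K, Fin (kdim (c i))) F) (hf : f.IsHomogeneous 2)
    (h1 : eval (kIn c i (h + v)) f = eval (kIn c i h) f)
    (h2 : eval (kIn c i (g + v)) f = eval (kIn c i g) f)
    (h3 : eval (kIn c i (g + h + v)) f = eval (kIn c i (g + h)) f) : eval (kIn c i v) f = 0 := by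
  have := (hom_two hf).1 (kIn c i g) (kIn c i h) (kIn c i v)
  simp only [← kIn_add] at this
  rw [h3, h2, h1] at this
  linear_combination this

lemma bad_point [Infinite F] (i : Fin K) (hi : ¬ kAllowed (c i)) :
    ∃ v : (Σ i : Fin K, Fin (kdim (c i))) → F, v ≠ 0 ∧ kPt1 c v = v ∧ kPt2 c v = v ∧
      ∀ (d : ℕ) (f : MvPolynomial (Σ i : Fin K, Fin (kdim (c i))) F), 0 < d → d < 4 →
        kAct1 c f = f → kAct2 c f = f → f.IsHomogeneous d → eval v f = 0 := by
  obtain ⟨v, h, g, u, hv, hv1, hv2, hcase⟩ := bad_block (c i) hi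
  refine ⟨kIn c i v, kIn_ne c i v hv, by rw [kPt1_kIn, hv1], by rw [kPt2_kIn, hv2], ?_⟩
  intro d f hd hd4 hf1 hf2 hf
  have hA : ∀ w, eval (kIn c i (kS1 (c i) *ᵥ w)) f = eval (kIn c i w) f := by
    intro w; rw [← kPt1_kIn, ← eval_kAct1, hf1]
  have hB : ∀ w, eval (kIn c i (kS2 (c i) *ᵥ w)) f = eval (kIn c i w) f := by
    intro w; rw [← kPt2_kIn, ← eval_kAct2, hf2]
  by_cases hd2 : d = 2
  · subst hd2
    rcases hcase with ⟨a1, a2, a3⟩ | ⟨a1, a2, a3⟩ | ⟨a1, a2, a3, a4, a5⟩ | ⟨a, a0, a1, a2, a3⟩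
    · refine two_vanish c i v h g f hf ?_ ?_ ?_
      · rw [← a1, hA]
      · rw [← a2, hB]
      · rw [← hB (g + h), Matrix.mulVec_add, a2, a3]; congr 2; abel_nf
    · refine two_vanish c i v h g f hf ?_ ?_ ?_
      · rw [← a1, hB]
      · rw [← a2, hA]
      · rw [← hA (g + h), Matrix.mulVec_add, a2, a3]; congr 2; abel_nf
    · have hself : ∀ w : Fin (kdim (c i)) → F, w + w = 0 := fun w => by
        funext q; exact CharTwo.add_self_eq_zero _
      have b1 : kS1 (c i) *ᵥ (kS2 (c i) *ᵥ g) = g + v := by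
        rw [a4, Matrix.mulVec_add, Matrix.mulVec_add, a3, a5, hv1, add_assoc g, hself, add_zero]
      have b2 : kS1 (c i) *ᵥ (kS2 (c i) *ᵥ h) = h := by
        rw [a2, Matrix.mulVec_add, a1, hv1, add_assoc, hself, add_zero]
      refine two_vanish c i v h g f hf ?_ ?_ ?_
      · rw [← a1, hA]
      · rw [← b1, hA, hB]
      · rw [← hB (g + h), ← hA (kS2 (c i) *ᵥ (g + h)), Matrix.mulVec_add (kS2 (c i)),
          Matrix.mulVec_add (kS1 (c i)), b1, b2]
        congr 2; abel_nf
    · obtain ⟨e, he⟩ := (hom_two hf).2 (kIn c i h) (kIn c i v)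
      have h1 := hA h
      have h2 := hB h
      rw [a2, ← one_smul F v, kIn_add, kIn_smul, he] at h1
      rw [a3, kIn_add, kIn_smul, he] at h2
      have : eval (kIn c i v) f * (a * (a - 1)) = 0 := by linear_combination h2 - a * h1
      exact (mul_eq_zero.1 this).resolve_right (mul_ne_zero a0 (sub_ne_zero.2 a1))
  · have hd' : f.IsHomogeneous 1 ∨ f.IsHomogeneous 3 := by
      obtain rfl | rfl : d = 1 ∨ d = 3 := by omega
      · exact Or.inl hf
      · exact Or.inr hf
    rcases hcase with ⟨a1, _, _⟩ | ⟨a1, _, _⟩ | ⟨a1, _⟩ | ⟨a, _, _, a1, _⟩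
    · exact odd_vanish c i _ v h hv1 a1 f hA hd'
    · exact odd_vanish c i _ v h hv2 a1 f hB hd'
    · exact odd_vanish c i _ v h hv1 a1 f hA hd'
    · exact odd_vanish c i _ v h hv1 a1 f hA hd'

lemma mov_point [Infinite F] (i : Fin K) (hi : c i ≠ KLabel.triv) :
    ∃ v : (Σ i : Fin K, Fin (kdim (c i))) → F, v ≠ 0 ∧ kPt1 c v = v ∧ kPt2 c v = v ∧
      ∀ (d : ℕ) (f : MvPolynomial (Σ i : Fin K, Fin (kdim (c i))) F), 0 < d → d < 2 →
        kAct1 c f = f → kAct2 c f = f → f.IsHomogeneous d → eval v f = 0 := by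
  obtain ⟨v, h, hv, hv1, hv2, hcase⟩ := mov_block (c i) hi
  refine ⟨kIn c i v, kIn_ne c i v hv, by rw [kPt1_kIn, hv1], by rw [kPt2_kIn, hv2], ?_⟩
  intro d f hd hd4 hf1 hf2 hf
  obtain rfl : d = 1 := by omega
  have hA : ∀ w, eval (kIn c i (kS1 (c i) *ᵥ w)) f = eval (kIn c i w) f := by
    intro w; rw [← kPt1_kIn, ← eval_kAct1, hf1]
  have hB : ∀ w, eval (kIn c i (kS2 (c i) *ᵥ w)) f = eval (kIn c i w) f := by
    intro w; rw [← kPt2_kIn, ← eval_kAct2, hf2]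
  rcases hcase with a1 | a1
  · exact odd_vanish c i _ v h hv1 a1 f hA (Or.inl hf)
  · exact odd_vanish c i _ v h hv2 a1 f hB (Or.inl hf)

/-- Degree set whose infimum is `ε`. -/
def kDeg (v : (Σ i : Fin K, Fin (kdim (c i))) → F) : Set ℕ :=
  {d : ℕ | 0 < d ∧ ∃ f : MvPolynomial (Σ i : Fin K, Fin (kdim (c i))) F,
    kAct1 c f = f ∧ kAct2 c f = f ∧ f.IsHomogeneous d ∧ eval v f ≠ 0}

lemma deg_le_two [Infinite F] (hc : ∀ i, kAllowed (c i))
    (v : (Σ i : Fin K, Fin (kdim (c i))) → F) (hv : v ≠ 0) : ∃ d ∈ kDeg c v, d ≤ 2 := by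
  obtain ⟨⟨i, s⟩, hs⟩ := Function.ne_iff.1 hv
  have hw : v ∘ Sigma.mk i ≠ 0 := fun h => hs (congrFun h s)
  obtain ⟨d, hd, hd2, f, hf, h1, h2, h3⟩ := allowed_block (c i) (hc i) _ hw
  refine ⟨d, ⟨hd, rename (Sigma.mk i) f, ?_, ?_, hf.rename_isHomogeneous, ?_⟩, hd2⟩
  · apply MvPolynomial.funext
    intro u
    rw [eval_kAct1, eval_rename, eval_rename]
    exact h1 (fun s => u ⟨i, s⟩)
  · apply MvPolynomial.funext
    intro u
    rw [eval_kAct2, eval_rename, eval_rename]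
    exact h2 (fun s => u ⟨i, s⟩)
  · rwa [eval_rename]

lemma kPt_rel (v : (Σ i : Fin K, Fin (kdim (c i))) → F) :
    kPt1 c (kPt1 c v) = v ∧ kPt2 c (kPt2 c v) = v ∧ kPt1 c (kPt2 c v) = kPt2 c (kPt1 c v) := by
  have e1 : ∀ (v : (Σ i : Fin K, Fin (kdim (c i))) → F) (i : Fin K) (s), kPt1 c v ⟨i, s⟩ =
    (kS1 (c i) *ᵥ (fun s => v ⟨i, s⟩)) s := fun _ _ _ => rfl
  have e2 : ∀ (v : (Σ i : Fin K, Fin (kdim (c i))) → F) (i : Fin K) (s), kPt2 c v ⟨i, s⟩ =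
    (kS2 (c i) *ᵥ (fun s => v ⟨i, s⟩)) s := fun _ _ _ => rfl
  refine ⟨?_, ?_, ?_⟩ <;> funext ⟨i, s⟩ <;> obtain ⟨r1, r2, r3⟩ := kS_rel (c i)
  · simp only [e1, Matrix.mulVec_mulVec]
    rw [r1, Matrix.one_mulVec]
  · simp only [e2, Matrix.mulVec_mulVec]
    rw [r2, Matrix.one_mulVec]
  · simp only [e1, e2, Matrix.mulVec_mulVec]
    rw [r3]

/-- linear form with given coefficients -/
noncomputable def linForm {σ : Type*} [Fintype σ] (a : σ → F) : MvPolynomial σ F :=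
  ∑ q, C (a q) * X q

lemma linForm_hom {σ : Type*} [Fintype σ] (a : σ → F) : (linForm a).IsHomogeneous 1 :=
  IsHomogeneous.sum _ _ _ fun _ _ => isHomogeneous_C_mul_X _ _

lemma eval_linForm {σ : Type*} [Fintype σ] (a v : σ → F) :
    eval v (linForm a) = ∑ q, a q * v q := by
  simp [linForm]

lemma linForm_ne {σ : Type*} [Fintype σ] (a : σ → F) (ha : a ≠ 0) : linForm a ≠ 0 := by
  classical
  obtain ⟨q, hq⟩ := Function.ne_iff.1 ha
  intro h
  apply hq
  have := eval_linForm a (Pi.single q 1)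
  rw [h] at this
  simpa [Pi.single_apply] using this.symm

lemma four_mem [Infinite F] (v : (Σ i : Fin K, Fin (kdim (c i))) → F) (hv : v ≠ 0) :
    4 ∈ kDeg c v := by
  have z1 : kPt1 c 0 = 0 := by funext q; simp [kPt1]
  have z2 : kPt2 c 0 = 0 := by funext q; simp [kPt2]
  have n1 : ∀ w, w ≠ 0 → kPt1 c w ≠ 0 := fun w hw h => hw (by rw [← (kPt_rel c w).1, h, z1])
  have n2 : ∀ w, w ≠ 0 → kPt2 c w ≠ 0 := fun w hw h => hw (by rw [← (kPt_rel c w).2.1, h, z2])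
  have hne : linForm v * linForm (kPt1 c v) * (linForm (kPt2 c v) * linForm (kPt1 c (kPt2 c v))) ≠
      0 :=
    mul_ne_zero (mul_ne_zero (linForm_ne _ hv) (linForm_ne _ (n1 _ hv)))
      (mul_ne_zero (linForm_ne _ (n2 _ hv)) (linForm_ne _ (n1 _ (n2 _ hv))))
  obtain ⟨a, ha⟩ : ∃ a, eval a (linForm v * linForm (kPt1 c v) *
      (linForm (kPt2 c v) * linForm (kPt1 c (kPt2 c v)))) ≠ 0 := by
    by_contra hcon
    push Not at hcon
    exact hne (MvPolynomial.funext fun x => by rw [hcon x, map_zero])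
  have hom1 : ∀ f : MvPolynomial (Σ i : Fin K, Fin (kdim (c i))) F, f.IsHomogeneous 1 →
      (kAct1 c f).IsHomogeneous 1 := fun f hf => by
    exact hf.aeval _ (n := 1)
      (fun q => IsHomogeneous.sum _ _ _ fun s _ => isHomogeneous_C_mul_X _ _)
  have hom2 : ∀ f : MvPolynomial (Σ i : Fin K, Fin (kdim (c i))) F, f.IsHomogeneous 1 →
      (kAct2 c f).IsHomogeneous 1 := fun f hf => by
    exact hf.aeval _ (n := 1)
      (fun q => IsHomogeneous.sum _ _ _ fun s _ => isHomogeneous_C_mul_X _ _)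
  have hl := linForm_hom a
  refine ⟨by norm_num, linForm a * kAct1 c (linForm a) *
    (kAct2 c (linForm a) * kAct2 c (kAct1 c (linForm a))), ?_, ?_, ?_, ?_⟩
  · apply MvPolynomial.funext
    intro u
    obtain ⟨r1, r2, r3⟩ := kPt_rel c u
    simp only [eval_kAct1, eval_kAct2, map_mul, r1, ← r3, (kPt_rel c (kPt2 c u)).1]
    ring
  · apply MvPolynomial.funext
    intro u
    obtain ⟨r1, r2, r3⟩ := kPt_rel c u
    simp only [eval_kAct1, eval_kAct2, map_mul, r2]
    ring
  · exact (hl.mul (hom1 _ hl)).mul ((hom2 _ hl).mul (hom2 _ (hom1 _ hl)))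
  · simp only [eval_kAct1, eval_kAct2, map_mul, eval_linForm] at ha ⊢
    convert ha using 1
    simp only [mul_comm]

lemma kEps_le_four [Infinite F] (v : (Σ i : Fin K, Fin (kdim (c i))) → F) (hv : v ≠ 0) :
    kEps c v ≤ 4 := Nat.sInf_le (four_mem c v hv)

lemma le_kEps [Infinite F] (v : (Σ i : Fin K, Fin (kdim (c i))) → F) (hv : v ≠ 0) (n : ℕ)
    (h : ∀ (d : ℕ) (f : MvPolynomial (Σ i : Fin K, Fin (kdim (c i))) F), 0 < d → d < n →
        kAct1 c f = f → kAct2 c f = f → f.IsHomogeneous d → eval v f = 0) : n ≤ kEps c v := by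
  obtain ⟨hd, f, h1, h2, h3, h4⟩ := Nat.sInf_mem (s := kDeg c v) ⟨4, four_mem c v hv⟩
  by_contra hlt
  push Not at hlt
  exact h4 (h _ f hd hlt h1 h2 h3)

lemma delta_gamma_eq [Infinite F] (n : ℕ)
    (hub : ∀ v : (Σ i : Fin K, Fin (kdim (c i))) → F, v ≠ 0 → kEps c v ≤ n)
    (hlb : ∃ v : (Σ i : Fin K, Fin (kdim (c i))) → F, v ≠ 0 ∧ kPt1 c v = v ∧ kPt2 c v = v ∧
      ∀ (d : ℕ) (f : MvPolynomial (Σ i : Fin K, Fin (kdim (c i))) F), 0 < d → d < n →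
        kAct1 c f = f → kAct2 c f = f → f.IsHomogeneous d → eval v f = 0) :
    kDelta c = n ∧ kGamma c = n := by
  obtain ⟨v, hv, h1, h2, h3⟩ := hlb
  have hn : n = kEps c v := le_antisymm (le_kEps c v hv n h3) (hub v hv)
  constructor
  · refine IsGreatest.csSup_eq ⟨⟨v, hv, h1, h2, hn⟩, ?_⟩
    rintro e ⟨w, hw, _, _, rfl⟩
    exact hub w hw
  · refine IsGreatest.csSup_eq ⟨⟨v, hv, hn⟩, ?_⟩
    rintro e ⟨w, hw, rfl⟩
    exact hub w hw

end Global

end CharTwo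

end Helpers

theorem stmt19 {F : Type*} [Field F] [IsAlgClosed F] [CharP F 2]
    {K : ℕ} (c : Fin K → KLabel F) (hV : ∃ i, c i ≠ KLabel.triv) :
    ((kDelta c = 2 ∧ kGamma c = 2) ↔ ∀ i, kAllowed (c i)) ∧
    ((∃ i, ¬ kAllowed (c i)) → kDelta c = 4 ∧ kGamma c = 4) := by
  have : Infinite F := inferInstance
  have hbad : (∃ i, ¬ kAllowed (c i)) → kDelta c = 4 ∧ kGamma c = 4 := by
    rintro ⟨i, hi⟩
    exact delta_gamma_eq c 4 (fun v hv => kEps_le_four c v hv) (bad_point c i hi)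
  refine ⟨⟨?_, ?_⟩, hbad⟩
  · intro h
    by_contra hcon
    push Not at hcon
    have := (hbad hcon).1
    omega
  · intro h
    obtain ⟨i, hi⟩ := hV
    refine delta_gamma_eq c 2 (fun v hv => ?_) (mov_point c i hi)
    obtain ⟨d, hd, hd2⟩ := deg_le_two c h v hv
    exact (Nat.sInf_le hd).trans hd2
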